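/- Stability of eigenvalue counting under small norm perturbation with unitary equivalence structure: let (A(δ))_{δ>0} and (B(δ))_{δ>0} be families of compact self-adjoint operators such that all B(δ) are unitarily equivalent to a fixed compact self-adjoint operator B, and suppose operators Q(δ) with ‖Q(δ)‖ ≤ 1 satisfy ‖A(δ) − Q(δ)B(δ)Q(δ)*‖ → 0, ‖(Q(δ)*Q(δ) − I)B(δ)‖ → 0, ‖(Q(δ)Q(δ)* − I)A(δ)‖ → 0 as δ → 0. Then for every s > 0 not in the spectrum of B, the counting functions satisfy N_{A(δ)}(s,∞) → N_B(s,∞) as δ → 0. -/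

import Mathlib

open ContinuousLinearMap Filter

/-- The eigenvalue counting function `N_T(s, ∞)`: the number of eigenvalues of `T`
in `(s, ∞)` counted with multiplicity. -/
noncomputable def eigCount {E : Type*} [NormedAddCommGroup E] [InnerProductSpace ℂ E]
    (T : E →L[ℂ] E) (s : ℝ) : ℕ :=
  Module.finrank ℂ
    ↥(⨆ μ : {μ : ℝ // s < μ}, Module.End.eigenspace (T : E →ₗ[ℂ] E) ((μ : ℝ) : ℂ))

open scoped InnerProductSpace

section SpectralSubspace

variable {E : Type*} [NormedAddCommGroup E] [InnerProductSpace ℂ E]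

/-- The algebraic span of the eigenspaces of `T` with real eigenvalue satisfying `p`. -/
def eigSpan (T : E →L[ℂ] E) (p : ℝ → Prop) : Submodule ℂ E :=
  ⨆ μ : {μ : ℝ // p μ}, Module.End.eigenspace (T : E →ₗ[ℂ] E) ((μ : ℝ) : ℂ)

theorem eigCount_eq_finrank_eigSpan (T : E →L[ℂ] E) (s : ℝ) :
    eigCount T s = Module.finrank ℂ (eigSpan T (s < ·)) := rfl

theorem exists_re_inner_map_self_eq_sum {T : E →L[ℂ] E}
    (hT : (T : E →ₗ[ℂ] E).IsSymmetric) {p : ℝ → Prop} {x : E} (hx : x ∈ eigSpan T p) :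
    ∃ (t : Finset {μ : ℝ // p μ}) (w : {μ : ℝ // p μ} → ℝ), (∀ i, 0 ≤ w i) ∧
      ‖x‖ ^ 2 = ∑ i ∈ t, w i ∧ (⟪T x, x⟫_ℂ).re = ∑ i ∈ t, (i : ℝ) * w i := by
  obtain ⟨f, hf, rfl⟩ := (Submodule.mem_iSup_iff_exists_finsupp _ _).1 hx
  have hV := hT.orthogonalFamily_eigenspaces.comp
    (Complex.ofReal_injective.comp (Subtype.val_injective (p := p)))
  have hTf (i : {μ : ℝ // p μ}) : T (f i) = ((i : ℝ) : ℂ) • f i :=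
    Module.End.mem_eigenspace_iff.1 (hf i)
  refine ⟨f.support, fun i => ‖f i‖ ^ 2, fun i => by positivity,
    hV.norm_sum (fun i => ⟨f i, hf i⟩) f.support, ?_⟩
  have key := hV.inner_sum (fun i => ((i : ℝ) : ℂ) • ⟨f i, hf i⟩) (fun i => ⟨f i, hf i⟩) f.support
  have hTx : T (f.sum fun _ y => y) = ∑ i ∈ f.support, ((i : ℝ) : ℂ) • f i := by
    simp [Finsupp.sum, map_sum, hTf]
  rw [hTx]
  refine (congrArg Complex.re key).trans ?_
  rw [Complex.re_sum]
  refine Finset.sum_congr rfl fun i _ => ?_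
  rw [inner_smul_left, inner_self_eq_norm_sq_to_K]
  simp [← Complex.ofReal_pow]

theorem mul_norm_sq_le_re_inner_of_mem_eigSpan {T : E →L[ℂ] E}
    (hT : (T : E →ₗ[ℂ] E).IsSymmetric) {a : ℝ} {x : E} (hx : x ∈ eigSpan T (a < ·)) :
    a * ‖x‖ ^ 2 ≤ (⟪T x, x⟫_ℂ).re := by
  obtain ⟨t, w, hw, h1, h2⟩ := exists_re_inner_map_self_eq_sum hT hx
  rw [h1, h2, Finset.mul_sum]
  exact Finset.sum_le_sum fun i _ => mul_le_mul_of_nonneg_right i.2.le (hw i)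

theorem re_inner_le_mul_norm_sq_of_mem_eigSpan {T : E →L[ℂ] E}
    (hT : (T : E →ₗ[ℂ] E).IsSymmetric) {a : ℝ} {x : E} (hx : x ∈ eigSpan T (· ≤ a)) :
    (⟪T x, x⟫_ℂ).re ≤ a * ‖x‖ ^ 2 := by
  obtain ⟨t, w, hw, h1, h2⟩ := exists_re_inner_map_self_eq_sum hT hx
  rw [h1, h2, Finset.mul_sum]
  exact Finset.sum_le_sum fun i _ => mul_le_mul_of_nonneg_right i.2 (hw i)

theorem eigSpan_isOrtho_eigSpan {T : E →L[ℂ] E}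
    (hT : (T : E →ₗ[ℂ] E).IsSymmetric) {p q : ℝ → Prop} (hpq : ∀ μ, p μ → ¬ q μ) :
    eigSpan T p ⟂ eigSpan T q := by
  refine Submodule.isOrtho_iSup_left.2 fun μ => Submodule.isOrtho_iSup_right.2 fun ν => ?_
  have hne : ((μ : ℝ) : ℂ) ≠ ((ν : ℝ) : ℂ) := fun h =>
    hpq μ μ.2 (Complex.ofReal_injective h ▸ ν.2)
  exact Submodule.isOrtho_iff_inner_eq.2 fun x hx y hy =>
    hT.orthogonalFamily_eigenspaces hne ⟨x, hx⟩ ⟨y, hy⟩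

theorem finiteDimensional_eigSpan_of_pos {T : E →L[ℂ] E} (hTc : IsCompactOperator (T : E → E))
    (hT : (T : E →ₗ[ℂ] E).IsSymmetric) {a : ℝ} (ha : 0 < a) :
    FiniteDimensional ℂ (eigSpan T (a < ·)) := by
  set V := eigSpan T (a < ·)
  set f : V →L[ℂ] E := T ∘L V.subtypeL
  have hanti : AntilipschitzWith (Real.toNNReal a⁻¹) f := by
    refine AddMonoidHomClass.antilipschitz_of_bound f fun x => ?_
    rw [Real.coe_toNNReal _ (by positivity), inv_mul_eq_div, le_div_iff₀ ha]
    rcases eq_or_ne x 0 with rfl | hx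
    · simp
    have hpos : 0 < ‖x‖ := norm_pos_iff.2 hx
    have h1 := mul_norm_sq_le_re_inner_of_mem_eigSpan hT x.2
    have h2 : (⟪T x, (x : E)⟫_ℂ).re ≤ ‖T x‖ * ‖x‖ := re_inner_le_norm (𝕜 := ℂ) (T x) (x : E)
    have h3 : ‖(x : E)‖ = ‖x‖ := rfl
    have h4 : ‖f x‖ = ‖T x‖ := rfl
    rw [h3] at h1
    rw [h4]
    exact le_of_mul_le_mul_right (by linarith) hpos
  obtain ⟨K, hK, hsub⟩ :=
    (hTc.comp_clm V.subtypeL : IsCompactOperator f).image_closedBall_subset_compact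
      (f := (f : V →ₗ[ℂ] E)) 1
  refine .of_totallyBounded_nhds_zero ℂ (Metric.closedBall_mem_nhds 0 one_pos) ?_
  have hind := hanti.isUniformInducing f.uniformContinuous
  exact (totallyBounded_preimage hind hK.totallyBounded).subset (Set.image_subset_iff.1 hsub)

theorem re_inner_le_mul_norm_sq_of_mem_orthogonal [CompleteSpace E] {T : E →L[ℂ] E}
    (hTc : IsCompactOperator (T : E → E)) (hT : (T : E →ₗ[ℂ] E).IsSymmetric) {a : ℝ} {x : E}
    (hx : x ∈ (eigSpan T (a < ·))ᗮ) : (⟪T x, x⟫_ℂ).re ≤ a * ‖x‖ ^ 2 := by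
  set V := eigSpan T (a < ·)
  set W := eigSpan T (· ≤ a)
  have hbot : Vᗮ ⊓ Wᗮ = ⊥ := by
    rw [Submodule.inf_orthogonal, eq_bot_iff,
      ← T.orthogonalComplement_iSup_eigenspaces_eq_bot hTc hT]
    refine Submodule.orthogonal_le (iSup_le fun μ => ?_)
    by_cases hμ : Module.End.HasEigenvalue (T : E →ₗ[ℂ] E) μ
    · obtain ⟨r, rfl⟩ := Complex.conj_eq_iff_real.1 (hT.conj_eigenvalue_eq_self hμ)
      rcases lt_or_ge a r with h | h
      · exact (le_iSup (fun ν : {ν : ℝ // a < ν} =>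
          Module.End.eigenspace (T : E →ₗ[ℂ] E) ((ν : ℝ) : ℂ)) ⟨r, h⟩).trans le_sup_left
      · exact (le_iSup (fun ν : {ν : ℝ // ν ≤ a} =>
          Module.End.eigenspace (T : E →ₗ[ℂ] E) ((ν : ℝ) : ℂ)) ⟨r, h⟩).trans le_sup_right
    · have hz : Module.End.eigenspace (T : E →ₗ[ℂ] E) μ = ⊥ := by
        simpa [Module.End.hasEigenvalue_iff] using hμ
      exact hz.le.trans bot_le
  have hWV : W.topologicalClosure ≤ Vᗮ :=
    W.topologicalClosure_minimal
      (eigSpan_isOrtho_eigSpan hT fun μ h h' => not_lt.2 h h') V.isClosed_orthogonal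
  have hxW : x ∈ W.topologicalClosure := by
    have : CompleteSpace W.topologicalClosure := W.isClosed_topologicalClosure.completeSpace_coe
    have h1 := W.topologicalClosure.sub_starProjection_mem_orthogonal x
    have h2 : x - W.topologicalClosure.starProjection x ∈ Vᗮ :=
      Submodule.sub_mem _ hx (hWV (Submodule.starProjection_apply_mem _ x))
    have h3 : x - W.topologicalClosure.starProjection x ∈ Vᗮ ⊓ Wᗮ :=
      ⟨h2, Submodule.orthogonal_le W.le_topologicalClosure h1⟩
    rw [hbot, Submodule.mem_bot, sub_eq_zero] at h3
    rw [h3]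
    exact Submodule.starProjection_apply_mem _ x
  have hclosed : IsClosed {y : E | (⟪T y, y⟫_ℂ).re ≤ a * ‖y‖ ^ 2} :=
    isClosed_le (Complex.continuous_re.comp (T.continuous.inner continuous_id)) (by fun_prop)
  exact closure_minimal (fun y hy => re_inner_le_mul_norm_sq_of_mem_eigSpan hT hy) hclosed hxW

theorem mem_spectrum_of_eigenspace_ne_bot {T : E →L[ℂ] E} {μ : ℝ}
    (h : Module.End.eigenspace (T : E →ₗ[ℂ] E) (μ : ℂ) ≠ ⊥) : μ ∈ spectrum ℝ T := by
  obtain ⟨x, hx, hx0⟩ := Submodule.exists_mem_ne_zero_of_ne_bot h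
  rw [Module.End.mem_eigenspace_iff] at hx
  rintro ⟨u, hu⟩
  refine hx0 ?_
  have h1 : (u : E →L[ℂ] E) x = 0 := by
    have hx' : T x = (μ : ℂ) • x := hx
    rw [hu, sub_apply, hx', Algebra.algebraMap_eq_smul_one]
    simp
  have h2 : ((↑u⁻¹ : E →L[ℂ] E) * u) x = x := by simp
  rw [← h2, mul_apply_eq_comp, h1, map_zero]

theorem eigCount_eq_of_spectrum_disjoint {T : E →L[ℂ] E} {a b : ℝ} (hab : a ≤ b)
    (h : ∀ μ ∈ Set.Ioc a b, μ ∉ spectrum ℝ T) : eigCount T a = eigCount T b := by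
  suffices eigSpan T (a < ·) = eigSpan T (b < ·) by
    rw [eigCount_eq_finrank_eigSpan, eigCount_eq_finrank_eigSpan, this]
  refine le_antisymm (iSup_le fun μ => ?_) (iSup_le fun μ => ?_)
  · rcases lt_or_ge b μ with hμ | hμ
    · exact le_iSup (fun ν : {ν : ℝ // b < ν} =>
        Module.End.eigenspace (T : E →ₗ[ℂ] E) ((ν : ℝ) : ℂ)) ⟨μ, hμ⟩
    · have hz := not_imp_comm.1 mem_spectrum_of_eigenspace_ne_bot (h μ ⟨μ.2, hμ⟩)
      exact hz.le.trans bot_le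
  · exact le_iSup (fun ν : {ν : ℝ // a < ν} =>
      Module.End.eigenspace (T : E →ₗ[ℂ] E) ((ν : ℝ) : ℂ)) ⟨μ, hab.trans_lt μ.2⟩

end SpectralSubspace

section Comparison

variable {E F : Type*} [NormedAddCommGroup E] [InnerProductSpace ℂ E]
  [NormedAddCommGroup F] [InnerProductSpace ℂ F]

theorem eigCount_le_of_re_inner_le [CompleteSpace F] {S : E →L[ℂ] E} {T : F →L[ℂ] F}
    (hS : (S : E →ₗ[ℂ] E).IsSymmetric) (hTc : IsCompactOperator (T : F → F))
    (hT : (T : F →ₗ[ℂ] F).IsSymmetric) {L : E →L[ℂ] F} (hL : ‖L‖ ≤ 1) {a b ε : ℝ} (hb : 0 < b)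
    (hab : b + ε < a)
    (h : ∀ x, (⟪S x, x⟫_ℂ).re ≤ (⟪T (L x), L x⟫_ℂ).re + ε * ‖x‖ ^ 2) :
    eigCount S a ≤ eigCount T b := by
  rw [eigCount_eq_finrank_eigSpan, eigCount_eq_finrank_eigSpan]
  set V := eigSpan S (a < ·)
  set W := eigSpan T (b < ·)
  have : FiniteDimensional ℂ W := finiteDimensional_eigSpan_of_pos hTc hT hb
  let f : V →ₗ[ℂ] W := (W.orthogonalProjectionOnto ∘L L ∘L V.subtypeL : V →L[ℂ] W)
  refine LinearMap.finrank_le_finrank_of_injective (f := f) ?_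
  refine (injective_iff_map_eq_zero f).2 fun x hx => ?_
  have hxW : L x ∈ Wᗮ := Submodule.orthogonalProjectionOnto_eq_zero_iff.1 hx
  have h1 := mul_norm_sq_le_re_inner_of_mem_eigSpan hS x.2
  have h2 := re_inner_le_mul_norm_sq_of_mem_orthogonal hTc hT hxW
  have h3 : ‖L x‖ ^ 2 ≤ ‖(x : E)‖ ^ 2 := by
    gcongr
    exact L.le_of_opNorm_le_of_le hL le_rfl |>.trans (one_mul _).le
  have h4 := mul_le_mul_of_nonneg_left h3 hb.le
  have h5 : (a - (b + ε)) * ‖(x : E)‖ ^ 2 ≤ 0 := by linarith [h x]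
  have h6 : ‖(x : E)‖ ^ 2 = 0 :=
    le_antisymm (nonpos_of_mul_nonpos_right h5 (by linarith)) (by positivity)
  simpa using h6

theorem abs_re_inner_apply_le (D : E →L[ℂ] E) {x y : E} {r : ℝ} (hx : ‖x‖ ≤ r) (hy : ‖y‖ ≤ r) :
    |(⟪D x, y⟫_ℂ).re| ≤ ‖D‖ * r ^ 2 := by
  have hr : 0 ≤ r := (norm_nonneg x).trans hx
  calc |(⟪D x, y⟫_ℂ).re| ≤ ‖⟪D x, y⟫_ℂ‖ := Complex.abs_re_le_norm _
    _ ≤ ‖D x‖ * ‖y‖ := norm_inner_le_norm _ _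
    _ ≤ (‖D‖ * r) * r := by gcongr; exact D.le_opNorm_of_le hx
    _ = ‖D‖ * r ^ 2 := by ring

variable [CompleteSpace E] [CompleteSpace F]

theorem re_inner_le_re_inner_adjoint_add (A : E →L[ℂ] E) (B : F →L[ℂ] F) (R : F →L[ℂ] E)
    (x : E) :
    (⟪A x, x⟫_ℂ).re ≤ (⟪B (adjoint R x), adjoint R x⟫_ℂ).re +
      ‖A - R ∘L B ∘L adjoint R‖ * ‖x‖ ^ 2 := by
  have h := (abs_le.1 (abs_re_inner_apply_le (A - R ∘L B ∘L adjoint R)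
    (le_refl ‖x‖) le_rfl)).2
  simp only [sub_apply, ContinuousLinearMap.comp_apply, inner_sub_left,
    Complex.sub_re] at h
  rw [adjoint_inner_right]
  linarith

theorem re_inner_le_re_inner_map_add (A : E →L[ℂ] E) {B : F →L[ℂ] F}
    (hB : (B : F →ₗ[ℂ] F).IsSymmetric) {R : F →L[ℂ] E} (hR : ‖R‖ ≤ 1) (x : F) :
    (⟪B x, x⟫_ℂ).re ≤ (⟪A (R x), R x⟫_ℂ).re +
      (‖A - R ∘L B ∘L adjoint R‖ + 2 * ‖(adjoint R ∘L R - 1) ∘L B‖) * ‖x‖ ^ 2 := by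
  set D := A - R ∘L B ∘L adjoint R with hD
  set G := (adjoint R ∘L R - 1) ∘L B with hG
  have hRx : ‖R x‖ ≤ ‖x‖ := (R.le_of_opNorm_le hR x).trans (one_mul _).le
  have hPx : ‖adjoint R (R x)‖ ≤ ‖x‖ :=
    ((adjoint R).le_of_opNorm_le ((adjoint.norm_map R).trans_le hR) (R x)).trans
      ((one_mul _).le.trans hRx)
  have h1 := (abs_le.1 (abs_re_inner_apply_le D hRx hRx)).1
  have h2 := (abs_le.1 (abs_re_inner_apply_le G le_rfl (le_refl ‖x‖))).1
  have h3 := (abs_le.1 (abs_re_inner_apply_le G hPx (le_refl ‖x‖))).1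
  have e1 : (⟪D (R x), R x⟫_ℂ).re = (⟪A (R x), R x⟫_ℂ).re -
      (⟪B (adjoint R (R x)), adjoint R (R x)⟫_ℂ).re := by
    simp [hD, adjoint_inner_right]
  have e2 : (⟪G x, x⟫_ℂ).re = (⟪B x, adjoint R (R x)⟫_ℂ).re - (⟪B x, x⟫_ℂ).re := by
    simp [hG, adjoint_inner_right, adjoint_inner_left]
  have e3 : (⟪G (adjoint R (R x)), x⟫_ℂ).re =
      (⟪B (adjoint R (R x)), adjoint R (R x)⟫_ℂ).re - (⟪B x, adjoint R (R x)⟫_ℂ).re := by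
    have hs : (⟪B (adjoint R (R x)), x⟫_ℂ).re = (⟪B x, adjoint R (R x)⟫_ℂ).re := by
      rw [show ⟪B (adjoint R (R x)), x⟫_ℂ = ⟪adjoint R (R x), B x⟫_ℂ from hB _ _]
      exact inner_re_symm (𝕜 := ℂ) _ _
    rw [← hs]
    simp [hG, adjoint_inner_right, adjoint_inner_left]
  linarith

theorem eigCount_eq_of_norm_lt {A : E →L[ℂ] E} {B : F →L[ℂ] F}
    (hAc : IsCompactOperator (A : E → E)) (hA : (A : E →ₗ[ℂ] E).IsSymmetric)
    (hBc : IsCompactOperator (B : F → F)) (hB : (B : F →ₗ[ℂ] F).IsSymmetric)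
    {R : F →L[ℂ] E} (hR : ‖R‖ ≤ 1) {s η : ℝ} (hηs : η < s)
    (hgap : ∀ μ ∈ Set.Icc (s - η) (s + η), μ ∉ spectrum ℝ B)
    (h : ‖A - R ∘L B ∘L adjoint R‖ + 2 * ‖(adjoint R ∘L R - 1) ∘L B‖ < η) :
    eigCount A s = eigCount B s := by
  have hG : 0 ≤ ‖(adjoint R ∘L R - 1) ∘L B‖ := norm_nonneg _
  have hD : 0 ≤ ‖A - R ∘L B ∘L adjoint R‖ := norm_nonneg _
  have hη : 0 < η := by linarith
  apply le_antisymm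
  · rw [← eigCount_eq_of_spectrum_disjoint (a := s - η) (b := s) (by linarith)
      fun μ hμ => hgap μ ⟨hμ.1.le, by linarith [hμ.2]⟩]
    exact eigCount_le_of_re_inner_le hA hBc hB ((adjoint.norm_map R).trans_le hR)
      (by linarith) (by linarith) (re_inner_le_re_inner_adjoint_add A B R)
  · rw [eigCount_eq_of_spectrum_disjoint (a := s) (b := s + η) (by linarith)
      fun μ hμ => hgap μ ⟨by linarith [hμ.1], hμ.2⟩]
    exact eigCount_le_of_re_inner_le hB hAc hA hR (by linarith) (by linarith)
      (re_inner_le_re_inner_map_add A hB hR)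

theorem norm_le_one_of_adjoint_comp_self {U : F →L[ℂ] E} (hU : adjoint U ∘L U = 1) :
    ‖U‖ ≤ 1 :=
  U.opNorm_le_bound zero_le_one fun x => by
    rw [one_mul, (norm_map_iff_adjoint_comp_self U).2 hU x]

end Comparison

/-- Stability of eigenvalue counting functions: if `A(δ)`, `B(δ)` are compact
self-adjoint, `B(δ) = U(δ) B U(δ)*` with `U(δ)` unitary, `‖Q(δ)‖ ≤ 1` and
`‖A(δ) − Q(δ)B(δ)Q(δ)*‖ → 0`, `‖(Q(δ)*Q(δ) − I)B(δ)‖ → 0`,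
`‖(Q(δ)Q(δ)* − I)A(δ)‖ → 0` as `δ → 0⁺`, then for every `s > 0` outside the spectrum
of `B` one has `N_{A(δ)}(s, ∞) → N_B(s, ∞)` as `δ → 0⁺`. -/
theorem eigCount_stability_of_model_approximation
    {𝓗 𝓚 : Type*} [NormedAddCommGroup 𝓗] [InnerProductSpace ℂ 𝓗] [CompleteSpace 𝓗]
    [NormedAddCommGroup 𝓚] [InnerProductSpace ℂ 𝓚] [CompleteSpace 𝓚]
    (A : ℝ → (𝓗 →L[ℂ] 𝓗)) (B' : ℝ → (𝓚 →L[ℂ] 𝓚)) (B : 𝓚 →L[ℂ] 𝓚)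
    (hAc : ∀ δ ∈ Set.Ioi (0 : ℝ), IsCompactOperator (A δ : 𝓗 → 𝓗))
    (hAsa : ∀ δ ∈ Set.Ioi (0 : ℝ), IsSelfAdjoint (A δ))
    (hBc : IsCompactOperator (B : 𝓚 → 𝓚)) (hBsa : IsSelfAdjoint B)
    (U : ℝ → (𝓚 →L[ℂ] 𝓚))
    (hU : ∀ δ ∈ Set.Ioi (0 : ℝ), U δ ∘L adjoint (U δ) = 1 ∧ adjoint (U δ) ∘L U δ = 1)
    (hB' : ∀ δ ∈ Set.Ioi (0 : ℝ), B' δ = U δ ∘L B ∘L adjoint (U δ))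
    (Q : ℝ → (𝓚 →L[ℂ] 𝓗)) (hQ : ∀ δ ∈ Set.Ioi (0 : ℝ), ‖Q δ‖ ≤ 1)
    (h1 : Tendsto (fun δ => ‖A δ - Q δ ∘L B' δ ∘L adjoint (Q δ)‖)
      (nhdsWithin 0 (Set.Ioi 0)) (nhds 0))
    (h2 : Tendsto (fun δ => ‖(adjoint (Q δ) ∘L Q δ - 1) ∘L B' δ‖)
      (nhdsWithin 0 (Set.Ioi 0)) (nhds 0))
    (h3 : Tendsto (fun δ => ‖(Q δ ∘L adjoint (Q δ) - 1) ∘L A δ‖)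
      (nhdsWithin 0 (Set.Ioi 0)) (nhds 0)) :
    ∀ s : ℝ, 0 < s → s ∉ spectrum ℝ B →
      Tendsto (fun δ => eigCount (A δ) s) (nhdsWithin 0 (Set.Ioi 0))
        (nhds (eigCount B s)) := by
  intro s hs hsB
  obtain ⟨ρ, hρ, hball⟩ := Metric.isOpen_iff.1 (spectrum.isClosed (𝕜 := ℝ) B).isOpen_compl s hsB
  obtain ⟨η, hη, hηlt⟩ := exists_between (lt_min hρ hs)
  have hgap : ∀ μ ∈ Set.Icc (s - η) (s + η), μ ∉ spectrum ℝ B := fun μ hμ =>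
    hball <| by
      rw [Metric.mem_ball, Real.dist_eq, abs_lt]
      have := hηlt.trans_le (min_le_left _ _)
      constructor <;> linarith [hμ.1, hμ.2]
  have hlim : Tendsto (fun δ => ‖A δ - Q δ ∘L B' δ ∘L adjoint (Q δ)‖ +
      2 * ‖(adjoint (Q δ) ∘L Q δ - 1) ∘L B' δ‖) (nhdsWithin 0 (Set.Ioi 0)) (nhds 0) := by
    simpa using h1.add (h2.const_mul 2)
  refine tendsto_const_nhds.congr' ?_
  filter_upwards [hlim.eventually_lt_const hη, self_mem_nhdsWithin] with δ hδ hδ0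
  obtain ⟨-, hU2⟩ := hU δ hδ0
  have hUn := norm_le_one_of_adjoint_comp_self hU2
  have hUn' : ‖adjoint (U δ)‖ ≤ 1 := (adjoint.norm_map (U δ)).trans_le hUn
  have hR : ‖Q δ ∘L U δ‖ ≤ 1 :=
    (opNorm_comp_le _ _).trans (mul_le_one₀ (hQ δ hδ0) (norm_nonneg _) hUn)
  have hUx (x : 𝓚) : adjoint (U δ) (U δ x) = x := DFunLike.congr_fun hU2 x
  have hD : A δ - (Q δ ∘L U δ) ∘L B ∘L adjoint (Q δ ∘L U δ) =
      A δ - Q δ ∘L B' δ ∘L adjoint (Q δ) := by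
    rw [hB' δ hδ0, adjoint_comp]
    rfl
  have hG : (adjoint (Q δ ∘L U δ) ∘L (Q δ ∘L U δ) - 1) ∘L B =
      adjoint (U δ) ∘L ((adjoint (Q δ) ∘L Q δ - 1) ∘L B' δ) ∘L U δ := by
    ext x
    simp [hB' δ hδ0, adjoint_comp, hUx]
  have hGn : ‖(adjoint (Q δ ∘L U δ) ∘L (Q δ ∘L U δ) - 1) ∘L B‖ ≤
      ‖(adjoint (Q δ) ∘L Q δ - 1) ∘L B' δ‖ := by
    rw [hG]
    refine (opNorm_comp_le _ _).trans ((mul_le_of_le_one_left (norm_nonneg _) hUn').trans ?_)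
    exact (opNorm_comp_le _ _).trans (mul_le_of_le_one_right (norm_nonneg _) hUn)
  refine (eigCount_eq_of_norm_lt (hAc δ hδ0) (hAsa δ hδ0).isSymmetric hBc hBsa.isSymmetric hR
    (hηlt.trans_le (min_le_right _ _)) hgap ?_).symm
  rw [hD]
  linarith
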